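/- Let s ∈ ℝ, 0 < b₂ < 1/2, and let η ∈ C_0^∞(ℝ) with supp η ⊂ [-1,1] and η ≡ 1 on [-1/2,1/2]. Then there exists C > 0 (depending only on s, b₂, η, and in particular independent of T) such that for every T ∈ (0,1] and every Schwartz function F : ℝ² → ℂ, ‖η(t/T) F(x,t)‖_{X^{s,b₂}} ≤ C ‖F‖_{X^{s,b₂}}. -/

import Mathlib

open MeasureTheory
open scoped Real

/-- Fourier transform on ℝ²: `f̂(ξ,τ) = (2π)^{-1} ∬ e^{-i(xξ+tτ)} f(x,t) dx dt`. -/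
noncomputable def FT2 (f : ℝ → ℝ → ℂ) (ξ τ : ℝ) : ℂ :=
  ((2 * π : ℝ) : ℂ)⁻¹ * ∫ x : ℝ, ∫ t : ℝ, Complex.exp (-Complex.I * (x * ξ + t * τ)) * f x t

/-- Bourgain `X^{s,b}` norm associated to `∂_t + ∂_x⁵`. -/
noncomputable def Xnorm (s b : ℝ) (f : ℝ → ℝ → ℂ) : ℝ :=
  Real.sqrt (∫ ξ : ℝ, ∫ τ : ℝ,
    (1 + |ξ|) ^ (2 * s) * (1 + |τ + ξ ^ 5|) ^ (2 * b) * ‖FT2 f ξ τ‖ ^ 2)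


lemma cs_weighted (k g q : ℝ → ENNReal) (hk : Measurable k) (hg : Measurable g) (hq : Measurable q)
    (hq0 : ∀ x, q x ≠ 0) (hqt : ∀ x, q x ≠ ⊤) :
    (∫⁻ y, k y * g y) ^ 2 ≤ (∫⁻ y, k y * q y) * ∫⁻ y, k y * (g y ^ 2 * (q y)⁻¹) := by
  have h := ENNReal.lintegral_mul_le_Lp_mul_Lq volume (p := 2) (q := 2)
    (by constructor <;> norm_num)
    (f := fun y => (k y * q y) ^ (1/2 : ℝ)) (g := fun y => (k y * (g y ^ 2 * (q y)⁻¹)) ^ (1/2 : ℝ))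
    (by fun_prop) (by fun_prop)
  have e : ∀ y, ((fun y => (k y * q y) ^ (1/2 : ℝ)) * (fun y => (k y * (g y ^ 2 * (q y)⁻¹)) ^ (1/2 : ℝ))) y
      = k y * g y := by
    intro y
    simp only [Pi.mul_apply]
    rw [← ENNReal.mul_rpow_of_nonneg _ _ (by norm_num)]
    have : k y * q y * (k y * (g y ^ 2 * (q y)⁻¹)) = (k y * g y) ^ 2 := by
      calc _ = (k y * g y) ^ 2 * (q y * (q y)⁻¹) := by ring
        _ = _ := by rw [ENNReal.mul_inv_cancel (hq0 y) (hqt y), mul_one]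
    rw [this, ← ENNReal.rpow_natCast, ← ENNReal.rpow_mul]
    norm_num
  have e2 : ∀ a : ENNReal, (a ^ (1/2:ℝ)) ^ (2:ℝ) = a := by
    intro a; rw [← ENNReal.rpow_mul]; norm_num
  simp only [e2] at h
  rw [lintegral_congr e] at h
  calc _ ≤ _ := pow_le_pow_left' h 2
    _ = _ := by
      rw [mul_pow, ← ENNReal.rpow_natCast, ← ENNReal.rpow_natCast]
      simp only [Nat.cast_ofNat, e2]

lemma schur (k : ℝ → ℝ → ENNReal) (g q : ℝ → ENNReal) (hk : Measurable (Function.uncurry k))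
    (hg : Measurable g) (hq : Measurable q)
    (hq0 : ∀ x, q x ≠ 0) (hqt : ∀ x, q x ≠ ⊤) (A B : ENNReal)
    (hA : ∀ x, ∫⁻ y, k x y * q y ≤ A * q x) (hB : ∀ y, ∫⁻ x, k x y * q x ≤ B * q y) :
    ∫⁻ x, (∫⁻ y, k x y * g y) ^ 2 ≤ A * B * ∫⁻ y, g y ^ 2 := by
  have hk1 : ∀ x, Measurable (k x) := fun x => hk.comp measurable_prodMk_left
  have hk2 : ∀ y, Measurable (fun x => k x y) := fun x => hk.comp measurable_prodMk_right
  calc ∫⁻ x, (∫⁻ y, k x y * g y) ^ 2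
      ≤ ∫⁻ x, A * q x * ∫⁻ y, k x y * (g y ^ 2 * (q y)⁻¹) := by
        refine lintegral_mono fun x => ?_
        refine (cs_weighted (k x) g q (hk1 x) hg hq hq0 hqt).trans ?_
        gcongr
        exact hA x
    _ = ∫⁻ x, ∫⁻ y, A * q x * (k x y * (g y ^ 2 * (q y)⁻¹)) := by
        refine lintegral_congr fun x => ?_
        rw [lintegral_const_mul]
        have := hk1 x
        fun_prop
    _ = ∫⁻ y, ∫⁻ x, A * q x * (k x y * (g y ^ 2 * (q y)⁻¹)) := by
        rw [lintegral_lintegral_swap]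
        have : Measurable (fun z : ℝ × ℝ => k z.1 z.2) := hk
        apply Measurable.aemeasurable
        unfold Function.uncurry
        fun_prop
    _ = ∫⁻ y, (A * (g y ^ 2 * (q y)⁻¹)) * ∫⁻ x, k x y * q x := by
        refine lintegral_congr fun y => ?_
        rw [← lintegral_const_mul]
        · refine lintegral_congr fun x => ?_
          ring
        have := hk2 y
        fun_prop
    _ ≤ ∫⁻ y, A * B * g y ^ 2 := by
        refine lintegral_mono fun y => ?_
        calc _ ≤ (A * (g y ^ 2 * (q y)⁻¹)) * (B * q y) := by gcongr; exact hB y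
          _ = A * B * g y ^ 2 * (q y * (q y)⁻¹) := by ring
          _ = _ := by rw [ENNReal.mul_inv_cancel (hq0 y) (hqt y), mul_one]
    _ = _ := by rw [lintegral_const_mul]; fun_prop

lemma lint_abs (φ : ℝ → ENNReal) (hφ : Measurable φ) :
    ∫⁻ x : ℝ, φ (1 + |x|) ≤ 2 * ∫⁻ y in Set.Ici 1, φ y := by
  have h0 : ∫⁻ x in Set.Ici (0:ℝ), φ (1 + |x|) = ∫⁻ y in Set.Ici 1, φ y := by
    rw [← lintegral_indicator measurableSet_Ici, ← lintegral_indicator measurableSet_Ici,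
      ← lintegral_add_left_eq_self ((Set.Ici (1:ℝ)).indicator _) (1:ℝ)]
    refine lintegral_congr fun x => ?_
    by_cases hx : 0 ≤ x
    · simp [Set.indicator, hx, abs_of_nonneg hx]
    · simp [Set.indicator, hx]
  have h1 : ∫⁻ x in Set.Iic (0:ℝ), φ (1 + |x|) = ∫⁻ y in Set.Ici 1, φ y := by
    rw [← h0, ← lintegral_indicator measurableSet_Ici, ← lintegral_indicator measurableSet_Iic,
      ← lintegral_neg_eq_self]
    refine lintegral_congr fun x => ?_
    by_cases hx : 0 ≤ x
    · simp [Set.indicator, hx]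
    · simp [Set.indicator, hx]
  calc ∫⁻ x : ℝ, φ (1 + |x|) = ∫⁻ x in Set.Iic (0:ℝ) ∪ Set.Ici 0, φ (1 + |x|) := by
        rw [Set.Iic_union_Ici, setLIntegral_univ]
    _ ≤ _ := lintegral_union_le _ _ _
    _ = _ := by rw [h0, h1, two_mul]

lemma int_low (b R : ℝ) (h1 : 0 < b) (h2 : b < 1/2) (hR : 1 ≤ R) :
    ∫⁻ y in Set.Ici 1, (if y ≤ R then ENNReal.ofReal (y ^ (-b - 1/2)) else 0) ≤
      ENNReal.ofReal (1 / (1/2 - b) * R ^ (1/2 - b)) := by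
  have : ∫⁻ y in Set.Ici 1, (if y ≤ R then ENNReal.ofReal (y ^ (-b - 1/2)) else 0)
      = ∫⁻ y in Set.Ioc 1 R, ENNReal.ofReal (y ^ (-b - 1/2)) := by
    rw [← restrict_Ioi_eq_restrict_Ici, ← lintegral_indicator measurableSet_Ioi, ← lintegral_indicator measurableSet_Ioc]
    refine lintegral_congr fun x => ?_
    simp only [Set.indicator, Set.mem_Ioi, Set.mem_Ioc]
    split_ifs <;> simp_all
  rw [this, ← ofReal_integral_eq_lintegral_ofReal, ← intervalIntegral.integral_of_le hR,
    integral_rpow (Or.inl (by linarith))]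
  · apply ENNReal.ofReal_le_ofReal
    have : -b - 1/2 + 1 = 1/2 - b := by ring
    rw [this, Real.one_rpow, div_mul_eq_mul_div, one_mul]
    have : 0 < 1/2 - b := by linarith
    gcongr
    linarith
  · have := (intervalIntegral.intervalIntegrable_rpow' (a := 1) (b := R) (r := -b - 1/2) (by linarith))
    exact (intervalIntegrable_iff_integrableOn_Ioc_of_le hR).1 this
  · filter_upwards [ae_restrict_mem measurableSet_Ioc] with y hy
    have : 0 < y := by linarith [hy.1]
    positivity

lemma int_high (b R : ℝ) (h1 : 0 < b) (h2 : b < 1/2) (hR : 1 ≤ R) :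
    ∫⁻ y in Set.Ici 1, (if R ≤ y then ENNReal.ofReal (y ^ (b - 3/2)) else 0) ≤
      ENNReal.ofReal (1 / (1/2 - b) * R ^ (b - 1/2)) := by
  have : ∫⁻ y in Set.Ici 1, (if R ≤ y then ENNReal.ofReal (y ^ (b - 3/2)) else 0)
      = ∫⁻ y in Set.Ioi R, ENNReal.ofReal (y ^ (b - 3/2)) := by
    rw [restrict_Ioi_eq_restrict_Ici, ← lintegral_indicator measurableSet_Ici, ← lintegral_indicator measurableSet_Ici]
    refine lintegral_congr fun x => ?_
    simp only [Set.indicator, Set.mem_Ici]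
    split_ifs <;> first | rfl | (exfalso; linarith)
  rw [this, ← ofReal_integral_eq_lintegral_ofReal, 
    integral_Ioi_rpow_of_lt (by linarith) (by linarith)]
  · apply ENNReal.ofReal_le_ofReal
    have : b - 3/2 + 1 = -(1/2 - b) := by ring
    rw [this, neg_div_neg_eq, div_mul_eq_mul_div, one_mul]
    have : -(1/2 - b) = b - 1/2 := by ring
    rw [this]
  · exact integrableOn_Ioi_rpow_of_lt (by linarith) (by linarith)
  · filter_upwards [ae_restrict_mem measurableSet_Ioi] with y hy
    have : 0 < y := by have := Set.mem_Ioi.1 hy; linarith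
    positivity

/-- Hardy type kernel. -/
noncomputable def hker (b x y : ℝ) : ENNReal :=
  if |y| ≤ |x| then ENNReal.ofReal ((1 + |x|) ^ (b - 1) * (1 + |y|) ^ (-b)) else 0

lemma hker_meas (b : ℝ) : Measurable (Function.uncurry (hker b)) := by
  unfold Function.uncurry hker
  refine Measurable.ite (measurableSet_le (by fun_prop) (by fun_prop)) ?_ (by fun_prop)
  fun_prop

lemma hardy (b : ℝ) (h1 : 0 < b) (h2 : b < 1/2) (g : ℝ → ENNReal) (hg : Measurable g) :
    ∫⁻ x, (∫⁻ y, hker b x y * g y) ^ 2 ≤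
      (ENNReal.ofReal (2 / (1/2 - b))) ^ 2 * ∫⁻ y, g y ^ 2 := by
  have hb : 0 < 1/2 - b := by linarith
  have hp : ∀ x : ℝ, 0 < 1 + |x| := fun x => by positivity
  rw [sq (ENNReal.ofReal _)]
  refine schur (hker b) g (fun x => ENNReal.ofReal ((1 + |x|) ^ (-(1/2) : ℝ))) (hker_meas b) hg
    (by fun_prop) ?_ (fun x => ENNReal.ofReal_ne_top) _ _ ?_ ?_
  · intro x
    have : 0 < (1 + |x|) ^ (-(1/2) : ℝ) := Real.rpow_pos_of_pos (hp x) _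
    simpa using this
  · intro x
    calc _ = ∫⁻ y, ENNReal.ofReal ((1 + |x|) ^ (b - 1)) *
              (fun z => if z ≤ 1 + |x| then ENNReal.ofReal (z ^ (-b - 1/2)) else 0) (1 + |y|) := by
            refine lintegral_congr fun y => ?_
            simp only [hker, add_le_add_iff_left]
            split_ifs
            · rw [← ENNReal.ofReal_mul (by positivity), ← ENNReal.ofReal_mul (by positivity), mul_assoc,
                ← Real.rpow_add (hp y)]
              congr 3
            · simp
      _ ≤ ENNReal.ofReal ((1 + |x|) ^ (b - 1)) * (2 * ENNReal.ofReal (1 / (1/2 - b) * (1 + |x|) ^ (1/2 - b))) := by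
            rw [lintegral_const_mul]
            · gcongr
              refine (lint_abs (fun z : ℝ => if z ≤ 1 + |x| then ENNReal.ofReal (z ^ (-b - 1/2)) else 0) ?_).trans ?_
              · exact Measurable.ite measurableSet_Iic (by fun_prop) (by fun_prop)
              · gcongr
                exact int_low b _ h1 h2 (by linarith [abs_nonneg x])
            · refine Measurable.comp (g := fun z : ℝ => if z ≤ 1 + |x| then ENNReal.ofReal (z ^ (-b - 1/2)) else 0)
                ?_ (by fun_prop)
              exact Measurable.ite measurableSet_Iic (by fun_prop) (by fun_prop)
      _ = _ := by
            have : (2 : ENNReal) = ENNReal.ofReal 2 := by simp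
            rw [this, ← ENNReal.ofReal_mul (by positivity), ← ENNReal.ofReal_mul (by positivity),
              ← ENNReal.ofReal_mul (by positivity)]
            congr 1
            have : (1 + |x|) ^ (-(1/2) : ℝ) = (1 + |x|) ^ (b - 1) * (1 + |x|) ^ (1/2 - b) := by
              rw [← Real.rpow_add (hp x)]; congr 1; ring
            rw [this]; ring
  · intro y
    calc _ = ∫⁻ x, ENNReal.ofReal ((1 + |y|) ^ (-b)) *
              (fun z => if 1 + |y| ≤ z then ENNReal.ofReal (z ^ (b - 3/2)) else 0) (1 + |x|) := by
            refine lintegral_congr fun x => ?_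
            simp only [hker, add_le_add_iff_left]
            split_ifs
            · rw [← ENNReal.ofReal_mul (by positivity), ← ENNReal.ofReal_mul (by positivity)]
              congr 1
              have : (1 + |x|) ^ (b - 3/2) = (1 + |x|) ^ (b - 1) * (1 + |x|) ^ (-(1/2) : ℝ) := by
                rw [← Real.rpow_add (hp x)]; congr 1; ring
              rw [this]; ring
            · simp
      _ ≤ ENNReal.ofReal ((1 + |y|) ^ (-b)) * (2 * ENNReal.ofReal (1 / (1/2 - b) * (1 + |y|) ^ (b - 1/2))) := by
            rw [lintegral_const_mul]
            · gcongr
              refine (lint_abs (fun z : ℝ => if 1 + |y| ≤ z then ENNReal.ofReal (z ^ (b - 3/2)) else 0) ?_).trans ?_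
              · exact Measurable.ite measurableSet_Ici (by fun_prop) (by fun_prop)
              · gcongr
                exact int_high b _ h1 h2 (by linarith [abs_nonneg y])
            · refine Measurable.comp (g := fun z : ℝ => if 1 + |y| ≤ z then ENNReal.ofReal (z ^ (b - 3/2)) else 0)
                ?_ (by fun_prop)
              exact Measurable.ite measurableSet_Ici (by fun_prop) (by fun_prop)
      _ = _ := by
            have : (2 : ENNReal) = ENNReal.ofReal 2 := by simp
            rw [this, ← ENNReal.ofReal_mul (by positivity), ← ENNReal.ofReal_mul (by positivity),
              ← ENNReal.ofReal_mul (by positivity)]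
            congr 1
            have : (1 + |y|) ^ (-(1/2) : ℝ) = (1 + |y|) ^ (-b) * (1 + |y|) ^ (b - 1/2) := by
              rw [← Real.rpow_add (hp y)]; congr 1; ring
            rw [this]; ring

lemma ker_bound (b B : ℝ) (h1 : 0 < b) (h2 : b < 1/2) (hB : 0 ≤ B) (κ : ℝ → ENNReal)
    (hκ : ∀ u, κ u ≤ ENNReal.ofReal (B / (1 + |u|))) (x y : ℝ) :
    ENNReal.ofReal ((1 + |x|) ^ b) * κ (x - y) ≤
      (2 * κ (x - y) + ENNReal.ofReal (2 * B) * hker b x y) * ENNReal.ofReal ((1 + |y|) ^ b) := by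
  have hx : 0 < 1 + |x| := by positivity
  have hy : 0 < 1 + |y| := by positivity
  by_cases h : |x| ≤ 2 * |y|
  · calc _ ≤ ENNReal.ofReal (2 * (1 + |y|) ^ b) * κ (x - y) := by
          gcongr
          calc (1 + |x|) ^ b ≤ (2 * (1 + |y|)) ^ b := by
                gcongr; linarith
            _ = 2 ^ b * (1 + |y|) ^ b := Real.mul_rpow (by norm_num) hy.le
            _ ≤ 2 ^ (1:ℝ) * (1 + |y|) ^ b := by
                gcongr
                · norm_num
                · linarith
            _ = _ := by norm_num
      _ = 2 * κ (x - y) * ENNReal.ofReal ((1 + |y|) ^ b) := by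
          rw [ENNReal.ofReal_mul (by norm_num)]
          simp only [ENNReal.ofReal_ofNat]
          ring
      _ ≤ _ := by gcongr; exact le_self_add
  · push Not at h
    have hxy : |y| ≤ |x| := by linarith [abs_nonneg y]
    calc _ ≤ ENNReal.ofReal ((1 + |x|) ^ b) * ENNReal.ofReal (2 * B / (1 + |x|)) := by
          gcongr
          refine (hκ _).trans (ENNReal.ofReal_le_ofReal ?_)
          have : |x| - |y| ≤ |x - y| := abs_sub_abs_le_abs_sub x y
          rw [div_le_div_iff₀ (by positivity) hx]
          nlinarith
      _ = ENNReal.ofReal (2 * B) * hker b x y * ENNReal.ofReal ((1 + |y|) ^ b) := by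
          rw [hker, if_pos hxy, ← ENNReal.ofReal_mul (by positivity), ← ENNReal.ofReal_mul (by positivity),
            ← ENNReal.ofReal_mul (by positivity)]
          congr 1
          rw [Real.rpow_neg hy.le, Real.rpow_sub hx, Real.rpow_one]
          have := Real.rpow_pos_of_pos hy b
          field_simp
      _ ≤ _ := by gcongr; exact le_add_self

lemma one_dim (b B : ℝ) (A : ENNReal) (h1 : 0 < b) (h2 : b < 1/2) (hB : 0 ≤ B) (κ : ℝ → ENNReal)
    (hκm : Measurable κ) (hκ : ∀ u, κ u ≤ ENNReal.ofReal (B / (1 + |u|))) (hA : ∫⁻ u, κ u ≤ A)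
    (g : ℝ → ENNReal) (hg : Measurable g) :
    ∫⁻ x, ENNReal.ofReal ((1 + |x|) ^ (2 * b)) * (∫⁻ y, κ (x - y) * g y) ^ 2 ≤
      (8 * A ^ 2 + 2 * (ENNReal.ofReal (2 * B)) ^ 2 * (ENNReal.ofReal (2 / (1/2 - b))) ^ 2) *
        ∫⁻ x, ENNReal.ofReal ((1 + |x|) ^ (2 * b)) * g x ^ 2 := by
  have hw : ∀ x : ℝ, ENNReal.ofReal ((1 + |x|) ^ (2 * b)) = ENNReal.ofReal ((1 + |x|) ^ b) ^ 2 := by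
    intro x
    rw [← ENNReal.ofReal_pow (by positivity), ← Real.rpow_natCast, ← Real.rpow_mul (by positivity)]
    congr 2; push_cast; ring
  set G : ℝ → ENNReal := fun y => ENNReal.ofReal ((1 + |y|) ^ b) * g y with hG
  have hGm : Measurable G := by fun_prop
  have hG2 : ∀ x, ENNReal.ofReal ((1 + |x|) ^ (2 * b)) * g x ^ 2 = G x ^ 2 := by
    intro x; rw [hw, hG, mul_pow]
  have hhm : ∀ x, Measurable (hker b x) := fun x => (hker_meas b).comp measurable_prodMk_left
  have S1 : ∫⁻ x, (∫⁻ y, κ (x - y) * G y) ^ 2 ≤ A * A * ∫⁻ y, G y ^ 2 := by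
    refine schur (fun x y => κ (x - y)) G (fun _ => 1) ?_ hGm (by fun_prop) (by simp) (by simp) _ _ ?_ ?_
    · unfold Function.uncurry; fun_prop
    · intro x
      simp only [mul_one]
      rw [lintegral_sub_left_eq_self]; exact hA
    · intro x
      simp only [mul_one]
      rw [lintegral_sub_right_eq_self]; exact hA
  have S2 := hardy b h1 h2 G hGm
  calc ∫⁻ x, ENNReal.ofReal ((1 + |x|) ^ (2 * b)) * (∫⁻ y, κ (x - y) * g y) ^ 2
      ≤ ∫⁻ x, (8 * (∫⁻ y, κ (x - y) * G y) ^ 2 +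
          2 * ENNReal.ofReal (2 * B) ^ 2 * (∫⁻ y, hker b x y * G y) ^ 2) := by
        refine lintegral_mono fun x => ?_
        have hx := hhm x
        have : ENNReal.ofReal ((1 + |x|) ^ b) * (∫⁻ y, κ (x - y) * g y) ≤
            2 * (∫⁻ y, κ (x - y) * G y) + ENNReal.ofReal (2 * B) * ∫⁻ y, hker b x y * G y := by
          rw [← lintegral_const_mul _ (by fun_prop), ← lintegral_const_mul _ (by fun_prop),
            ← lintegral_const_mul _ (by fun_prop), ← lintegral_add_left (by fun_prop)]
          refine lintegral_mono fun y => ?_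
          calc _ = (ENNReal.ofReal ((1 + |x|) ^ b) * κ (x - y)) * g y := by ring
            _ ≤ _ := mul_le_mul_left (ker_bound b B h1 h2 hB κ hκ x y) _
            _ = _ := by simp only [hG]; ring
        dsimp only
        rw [hw, ← mul_pow]
        refine (pow_le_pow_left' this 2).trans ?_
        have h3 := ENNReal.rpow_add_le_mul_rpow_add_rpow (2 * (∫⁻ y, κ (x - y) * G y))
          (ENNReal.ofReal (2 * B) * ∫⁻ y, hker b x y * G y) (p := 2) (by norm_num)
        rw [show (2:ℝ) - 1 = 1 by norm_num, ENNReal.rpow_one, ENNReal.rpow_two, ENNReal.rpow_two,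
          ENNReal.rpow_two] at h3
        refine h3.trans (le_of_eq ?_)
        ring
    _ = 8 * (∫⁻ x, (∫⁻ y, κ (x - y) * G y) ^ 2) +
          2 * ENNReal.ofReal (2 * B) ^ 2 * ∫⁻ x, (∫⁻ y, hker b x y * G y) ^ 2 := by
        have m1 : Measurable fun x => ∫⁻ y, κ (x - y) * G y := by
          apply Measurable.lintegral_prod_right'
            (f := fun z : ℝ × ℝ => κ (z.1 - z.2) * G z.2)
          fun_prop
        have m2 : Measurable fun x => ∫⁻ y, hker b x y * G y := by
          have := hker_meas b
          unfold Function.uncurry at this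
          apply Measurable.lintegral_prod_right'
            (f := fun z : ℝ × ℝ => hker b z.1 z.2 * G z.2)
          fun_prop
        rw [lintegral_add_left (by fun_prop), lintegral_const_mul _ (by fun_prop),
          lintegral_const_mul _ (by fun_prop)]
    _ ≤ 8 * (A * A * ∫⁻ y, G y ^ 2) + 2 * ENNReal.ofReal (2 * B) ^ 2 *
          ((ENNReal.ofReal (2 / (1/2 - b))) ^ 2 * ∫⁻ y, G y ^ 2) := by gcongr
    _ = _ := by
        rw [lintegral_congr hG2]; ring

open scoped FourierTransform in
lemma FT2_schwartz (F : SchwartzMap (ℝ × ℝ) ℂ) :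
    ∃ G : SchwartzMap (WithLp 2 (ℝ × ℝ)) ℂ, ∀ ξ τ : ℝ,
      FT2 (fun x t => F (x, t)) ξ τ =
        ((2 * π : ℝ) : ℂ)⁻¹ * G (WithLp.toLp 2 ((2 * π)⁻¹ * ξ, (2 * π)⁻¹ * τ)) := by
  let L := WithLp.prodContinuousLinearEquiv 2 ℝ ℝ ℝ
  let F' : SchwartzMap (WithLp 2 (ℝ × ℝ)) ℂ := SchwartzMap.compCLMOfContinuousLinearEquiv ℂ L F
  refine ⟨𝓕 F', fun ξ τ => ?_⟩
  unfold FT2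
  congr 1
  rw [SchwartzMap.fourier_coe, Real.fourier_eq']
  have hi : Integrable (fun z : ℝ × ℝ => Complex.exp (-Complex.I * (z.1 * ξ + z.2 * τ)) * F z) := by
    have hF : Integrable (fun z => F z) (volume : Measure (ℝ × ℝ)) := F.integrable
    refine hF.bdd_mul (c := 1) (by fun_prop) (Filter.Eventually.of_forall fun z => ?_)
    rw [Complex.norm_exp]; simp
  rw [← (WithLp.volume_preserving_toLp ℝ ℝ).integral_comp (MeasurableEquiv.toLp 2 (ℝ × ℝ)).measurableEmbedding]
  rw [Measure.volume_eq_prod, integral_prod _ ?_]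
  · refine integral_congr_ae (Filter.Eventually.of_forall fun x => ?_)
    refine integral_congr_ae (Filter.Eventually.of_forall fun t => ?_)
    simp only [F', L, smul_eq_mul]
    congr 2
    simp
    field_simp
  · convert! hi using 2 with z
    simp only [F', L, smul_eq_mul]
    refine congrArg₂ (· * ·) (congrArg Complex.exp ?_) rfl
    simp
    field_simp

lemma FT2_cont (F : SchwartzMap (ℝ × ℝ) ℂ) :
    Continuous (fun z : ℝ × ℝ => FT2 (fun x t => F (x, t)) z.1 z.2) := by
  obtain ⟨G, hG⟩ := FT2_schwartz F
  simp only [hG]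
  have := G.continuous
  fun_prop

lemma FT2_cont_right (F : SchwartzMap (ℝ × ℝ) ℂ) (ξ : ℝ) :
    Continuous (fun τ : ℝ => FT2 (fun x t => F (x, t)) ξ τ) := by
  obtain ⟨G, hG⟩ := FT2_schwartz F
  simp only [hG]
  have := G.continuous
  fun_prop

lemma FT2_decay (F : SchwartzMap (ℝ × ℝ) ℂ) (k : ℕ) :
    ∃ C : ℝ, 0 ≤ C ∧ ∀ ξ τ : ℝ, (1 + |ξ|) ^ k * (1 + |τ|) ^ k *
      ‖FT2 (fun x t => F (x, t)) ξ τ‖ ^ 2 ≤ C := by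
  obtain ⟨G, hG⟩ := FT2_schwartz F
  have hd := fun z => SchwartzMap.one_add_le_sup_seminorm_apply (𝕜 := ℂ) (m := (k, 0)) (k := k) (n := 0)
    le_rfl le_rfl G z
  set D := 2 ^ (k, 0).1 * (Finset.Iic (k, 0)).sup (fun m => SchwartzMap.seminorm ℂ m.1 m.2) G with hD
  have hD0 : 0 ≤ D := le_trans (by positivity) (hd 0)
  refine ⟨(((2 * π) ^ k) * D) ^ 2, by positivity, fun ξ τ => ?_⟩
  set z := WithLp.toLp 2 ((2 * π)⁻¹ * ξ, (2 * π)⁻¹ * τ) with hz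
  have hp : (1:ℝ) ≤ 2 * π := by nlinarith [Real.pi_gt_three]
  have h1 : (2 * π)⁻¹ * |ξ| ≤ ‖z‖ := by
    have := WithLp.prod_norm_sq_eq_of_L2 z
    apply abs_le_of_sq_le_sq' _ (norm_nonneg _) |>.2
    rw [this, hz]
    simp [mul_pow]; positivity
  have h2 : (2 * π)⁻¹ * |τ| ≤ ‖z‖ := by
    have := WithLp.prod_norm_sq_eq_of_L2 z
    apply abs_le_of_sq_le_sq' _ (norm_nonneg _) |>.2
    rw [this, hz]
    simp [mul_pow]; positivity
  have aux : ∀ r : ℝ, (2 * π)⁻¹ * |r| ≤ ‖z‖ → 1 + |r| ≤ 2 * π * (1 + ‖z‖) := by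
    intro r hr
    have : |r| ≤ 2 * π * ‖z‖ := by
      rw [inv_mul_le_iff₀ (by positivity)] at hr; exact hr
    nlinarith
  have h3 := hd z
  rw [norm_iteratedFDeriv_zero] at h3
  rw [hG, norm_mul]
  have h4 : ‖((2 * π : ℝ) : ℂ)⁻¹‖ ≤ 1 := by
    rw [norm_inv, Complex.norm_real, Real.norm_of_nonneg (by positivity)]
    exact inv_le_one_of_one_le₀ hp
  calc _ ≤ (2 * π * (1 + ‖z‖)) ^ k * (2 * π * (1 + ‖z‖)) ^ k * (1 * ‖G z‖) ^ 2 := by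
        gcongr
        · exact aux _ h1
        · exact aux _ h2
    _ = ((2 * π) ^ k * ((1 + ‖z‖) ^ k * ‖G z‖)) ^ 2 := by rw [mul_pow]; ring
    _ ≤ _ := by gcongr

lemma X_integrable (s b : ℝ) (h1 : 0 < b) (h2 : b < 1/2) (F : SchwartzMap (ℝ × ℝ) ℂ) :
    Integrable (fun z : ℝ × ℝ => (1 + |z.1|) ^ (2 * s) * (1 + |z.2 + z.1 ^ 5|) ^ (2 * b) *
      ‖FT2 (fun x t => F (x, t)) z.1 z.2‖ ^ 2) := by
  obtain ⟨k, hk⟩ := exists_nat_gt (2 * |s| + 7)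
  obtain ⟨C, hC, hb⟩ := FT2_decay F k
  have hi : Integrable (fun z : ℝ × ℝ => C * ((1 + |z.1|) ^ (-2 : ℝ) * (1 + |z.2|) ^ (-2 : ℝ))) := by
    have h0 : Integrable (fun x : ℝ => (1 + |x|) ^ (-2 : ℝ)) := by
      have := integrable_one_add_norm (E := ℝ) (μ := volume) (r := 2) (by simp)
      simpa using this
    exact (h0.mul_prod h0).const_mul C
  have hc := FT2_cont F
  refine hi.mono' ?_ (Filter.Eventually.of_forall fun z => ?_)
  · apply Measurable.aestronglyMeasurable
    have := hc.measurable
    fun_prop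
  · obtain ⟨x, t⟩ := z
    simp only
    rw [Real.norm_of_nonneg (by positivity)]
    have hx : (1:ℝ) ≤ 1 + |x| := by linarith [abs_nonneg x]
    have ht : (1:ℝ) ≤ 1 + |t| := by linarith [abs_nonneg t]
    have e1 : (1 + |x|) ^ (2 * s) ≤ (1 + |x|) ^ (2 * |s|) :=
      Real.rpow_le_rpow_of_exponent_le hx (by linarith [le_abs_self s])
    have e2 : (1 + |t + x ^ 5|) ^ (2 * b) ≤ (1 + |x|) ^ (5:ℝ) * (1 + |t|) ^ (1:ℝ) := by
      calc (1 + |t + x ^ 5|) ^ (2 * b) ≤ (1 + |t + x ^ 5|) ^ (1:ℝ) :=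
            Real.rpow_le_rpow_of_exponent_le (by linarith [abs_nonneg (t + x^5)]) (by linarith)
        _ ≤ _ := by
            have : (1 + |x|) ^ (5:ℝ) = (1 + |x|) ^ 5 := by
              rw [← Real.rpow_natCast]; norm_num
            rw [Real.rpow_one, Real.rpow_one, this]
            have a1 : |t + x ^ 5| ≤ |t| + |x| ^ 5 := by
              rw [← abs_pow]; exact abs_add_le _ _
            have a2 : 1 + |x| ^ 5 ≤ (1 + |x|) ^ 5 := by
              have : 0 ≤ |x| := abs_nonneg x
              have h : (1 + |x|) ^ 5 = 1 + |x| ^ 5 + (5 * |x| + 10 * |x|^2 + 10 * |x|^3 + 5 * |x|^4) := by ring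
              rw [h]
              have : 0 ≤ 5 * |x| + 10 * |x|^2 + 10 * |x|^3 + 5 * |x|^4 := by positivity
              linarith
            have a3 : 0 ≤ |x| ^ 5 := by positivity
            nlinarith [abs_nonneg t]
    have e3 : (1 + |x|) ^ (2 * |s|) * (1 + |x|) ^ (5:ℝ) ≤ (1 + |x|) ^ (-2:ℝ) * (1 + |x|) ^ k := by
      rw [← Real.rpow_add (by positivity), ← Real.rpow_natCast (1 + |x|) k, ← Real.rpow_add (by positivity)]
      exact Real.rpow_le_rpow_of_exponent_le hx (by linarith)
    have e4 : (1 + |t|) ^ (1:ℝ) ≤ (1 + |t|) ^ (-2:ℝ) * (1 + |t|) ^ k := by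
      rw [← Real.rpow_natCast (1 + |t|) k, ← Real.rpow_add (by positivity)]
      exact Real.rpow_le_rpow_of_exponent_le ht (by linarith [abs_nonneg s])
    set N := ‖FT2 (fun x t => F (x, t)) x t‖ ^ 2
    have hN : 0 ≤ N := by positivity
    calc _ ≤ (1 + |x|) ^ (2 * |s|) * ((1 + |x|) ^ (5:ℝ) * (1 + |t|) ^ (1:ℝ)) * N := by gcongr
      _ = ((1 + |x|) ^ (2 * |s|) * (1 + |x|) ^ (5:ℝ)) * (1 + |t|) ^ (1:ℝ) * N := by ring
      _ ≤ ((1 + |x|) ^ (-2:ℝ) * (1 + |x|) ^ k) * ((1 + |t|) ^ (-2:ℝ) * (1 + |t|) ^ k) * N := by gcongr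
      _ = ((1 + |x|) ^ (-2:ℝ) * (1 + |t|) ^ (-2:ℝ)) * ((1 + |x|) ^ k * (1 + |t|) ^ k * N) := by ring
      _ ≤ ((1 + |x|) ^ (-2:ℝ) * (1 + |t|) ^ (-2:ℝ)) * C := by gcongr; exact hb x t
      _ = _ := by ring

lemma FT2_mul (F : SchwartzMap (ℝ × ℝ) ℂ) (K : ℝ → ℂ) (hK : Integrable K) (ψ : ℝ → ℂ)
    (hψ : ∀ t : ℝ, ψ t = ∫ u : ℝ, Complex.exp (Complex.I * (t * u)) * K u) (ξ τ : ℝ) :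
    FT2 (fun x t => ψ t * F (x, t)) ξ τ = ∫ u, K u * FT2 (fun x t => F (x, t)) ξ (τ - u) := by
  have hF : Integrable (fun z => F z) (volume : Measure (ℝ × ℝ)) := F.integrable
  let P : ℝ × ℝ → ℝ → ℂ := fun z u =>
    Complex.exp (-Complex.I * (z.1 * ξ + z.2 * τ) + Complex.I * (z.2 * u)) * (F z * K u)
  have hP : Integrable (Function.uncurry P) ((volume : Measure (ℝ × ℝ)).prod volume) := by
    refine (hF.mul_prod hK).bdd_mul (c := 1) (Continuous.aestronglyMeasurable (by fun_prop))
      (Filter.Eventually.of_forall fun z => ?_)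
    rw [Complex.norm_exp]; simp
  have hPu : ∀ u, Integrable (fun z => P z u) (volume : Measure (ℝ × ℝ)) := by
    intro u
    refine (hF.mul_const (K u)).bdd_mul (c := 1) (Continuous.aestronglyMeasurable (by fun_prop))
      (Filter.Eventually.of_forall fun z => ?_)
    rw [Complex.norm_exp]; simp
  have key : ∫ x : ℝ, ∫ t : ℝ, ∫ u, P (x, t) u = ∫ u, ∫ x : ℝ, ∫ t : ℝ, P (x, t) u := by
    have a : ∫ x : ℝ, ∫ t : ℝ, ∫ u, P (x, t) u = ∫ z : ℝ × ℝ, ∫ u, P z u := by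
      rw [Measure.volume_eq_prod, integral_prod]
      exact hP.integral_prod_left
    rw [a, integral_integral_swap hP]
    refine integral_congr_ae (Filter.Eventually.of_forall fun u => ?_)
    simp only
    rw [Measure.volume_eq_prod, integral_prod]
    exact hPu u
  unfold FT2
  have l : ∀ x t : ℝ, Complex.exp (-Complex.I * (x * ξ + t * τ)) * (ψ t * F (x, t)) = ∫ u, P (x, t) u := by
    intro x t
    rw [hψ, mul_comm _ (F (x,t)), ← mul_assoc, ← integral_const_mul]
    refine integral_congr_ae (Filter.Eventually.of_forall fun u => ?_)
    simp only [P, Complex.exp_add]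
    ring
  simp only [l]
  rw [key, ← integral_const_mul]
  refine integral_congr_ae (Filter.Eventually.of_forall fun u => ?_)
  simp only
  rw [mul_left_comm]
  congr 1
  rw [← integral_const_mul]
  refine integral_congr_ae (Filter.Eventually.of_forall fun x => ?_)
  simp only
  rw [← integral_const_mul]
  refine integral_congr_ae (Filter.Eventually.of_forall fun t => ?_)
  simp only [P]
  have : -Complex.I * (x * ξ + t * τ) + Complex.I * (t * u) = -Complex.I * (x * ξ + t * ((τ - u : ℝ) : ℂ)) := by
    push_cast; ring
  rw [this]; ring

open scoped FourierTransform in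
lemma cutoff_kernel (η : ℝ → ℂ) (hηsmooth : ContDiff ℝ (⊤ : ℕ∞) η)
    (hηsupp : Function.support η ⊆ Set.Icc (-1 : ℝ) 1) :
    ∃ A B : ℝ, 0 ≤ A ∧ 0 ≤ B ∧ ∀ T ∈ Set.Ioc (0:ℝ) 1, ∃ K : ℝ → ℂ, Continuous K ∧ Integrable K ∧
      (∀ t : ℝ, η (t / T) = ∫ u : ℝ, Complex.exp (Complex.I * (t * u)) * K u) ∧
      (∫⁻ u, ‖K u‖ₑ ≤ ENNReal.ofReal A) ∧ ∀ u, ‖K u‖ₑ ≤ ENNReal.ofReal (B / (1 + |u|)) := by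
  have hcs : HasCompactSupport η := HasCompactSupport.of_support_subset_isCompact isCompact_Icc hηsupp
  let η' : SchwartzMap ℝ ℂ := hcs.toSchwartzMap hηsmooth
  let E : SchwartzMap ℝ ℂ := 𝓕 η'
  have hEi : Integrable (fun v => E v) (volume : Measure ℝ) := E.integrable
  have hinv : ∀ t : ℝ, η t = ∫ v : ℝ, Complex.exp ((2 * π * (v * t) : ℝ) * Complex.I) * E v := by
    intro t
    have : η' = 𝓕⁻ E := by simp [E]
    have h2 : η t = (𝓕⁻ E) t := by rw [← this]; rfl
    rw [h2, SchwartzMap.fourierInv_coe, Real.fourierInv_eq']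
    simp [mul_comm t]
  have hd := fun z => SchwartzMap.one_add_le_sup_seminorm_apply (𝕜 := ℂ) (m := (1, 0)) (k := 1) (n := 0)
    le_rfl le_rfl E z
  set D := 2 ^ (1, 0).1 * (Finset.Iic (1, 0)).sup (fun m => SchwartzMap.seminorm ℂ m.1 m.2) E with hD
  have hD0 : 0 ≤ D := le_trans (by positivity) (hd 0)
  refine ⟨∫ v, ‖E v‖, D, by positivity, hD0, fun T hT => ?_⟩
  have hT0 : 0 < T := hT.1
  set a := T / (2 * π) with ha
  have ha0 : 0 < a := by positivity
  have ha1 : a ≤ 1 := by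
    rw [ha, div_le_one (by positivity)]
    nlinarith [Real.pi_gt_three, hT.2]
  have hEc := E.continuous
  have hKi : Integrable (fun u => (a : ℂ) * E (a * u)) :=
    (hEi.comp_mul_left' ha0.ne').const_mul _
  refine ⟨fun u => (a : ℂ) * E (a * u), by fun_prop, hKi, fun t => ?_, ?_, fun u => ?_⟩
  · have := Measure.integral_comp_mul_left
      (fun v : ℝ => Complex.exp ((2 * π * (v * (t / T)) : ℝ) * Complex.I) * E v) a
    rw [← hinv, abs_of_pos (by positivity)] at this
    have h3 : η (t / T) = (a : ℂ) * ∫ x : ℝ, Complex.exp ((2 * π * ((a * x) * (t / T)) : ℝ) * Complex.I) * E (a * x) := by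
      rw [this, Complex.real_smul, ← mul_assoc, ← Complex.ofReal_mul, mul_inv_cancel₀ ha0.ne']
      simp
    rw [h3, ← integral_const_mul]
    refine integral_congr_ae (Filter.Eventually.of_forall fun x => ?_)
    simp only
    have : (((2 * π * ((a * x) * (t / T)) : ℝ)) : ℂ) * Complex.I = Complex.I * (t * x) := by
      have : 2 * π * ((a * x) * (t / T)) = t * x := by
        rw [ha]; field_simp
      rw [this]; push_cast; ring
    rw [this]; ring
  · rw [← ofReal_integral_norm_eq_lintegral_enorm hKi]
    apply ENNReal.ofReal_le_ofReal
    have := Measure.integral_comp_mul_left (fun v : ℝ => ‖E v‖) a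
    simp only [norm_mul, Complex.norm_real]
    rw [integral_const_mul, this, Real.norm_of_nonneg ha0.le, abs_of_pos (by positivity), smul_eq_mul,
      ← mul_assoc, mul_inv_cancel₀ ha0.ne', one_mul]
  · rw [← ofReal_norm]
    apply ENNReal.ofReal_le_ofReal
    have h3 := hd (a * u)
    rw [norm_iteratedFDeriv_zero, pow_one, Real.norm_eq_abs, abs_mul, abs_of_pos ha0] at h3
    rw [norm_mul, Complex.norm_real, Real.norm_of_nonneg ha0.le, le_div_iff₀ (by positivity)]
    refine le_trans ?_ h3
    have : a * ‖E (a * u)‖ * (1 + |u|) = (a + a * |u|) * ‖E (a * u)‖ := by ring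
    rw [this]
    gcongr

lemma ofReal_le_enorm (r : ℝ) : ENNReal.ofReal r ≤ ‖r‖ₑ := by
  rw [← ofReal_norm]
  exact ENNReal.ofReal_le_ofReal (le_abs_self r)

lemma one_dim_shift (b B c : ℝ) (A : ENNReal) (h1 : 0 < b) (h2 : b < 1/2) (hB : 0 ≤ B) (κ : ℝ → ENNReal)
    (hκm : Measurable κ) (hκ : ∀ u, κ u ≤ ENNReal.ofReal (B / (1 + |u|))) (hA : ∫⁻ u, κ u ≤ A)
    (g : ℝ → ENNReal) (hg : Measurable g) :
    ∫⁻ x, ENNReal.ofReal ((1 + |x + c|) ^ (2 * b)) * (∫⁻ u, κ u * g (x - u)) ^ 2 ≤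
      (8 * A ^ 2 + 2 * (ENNReal.ofReal (2 * B)) ^ 2 * (ENNReal.ofReal (2 / (1/2 - b))) ^ 2) *
        ∫⁻ x, ENNReal.ofReal ((1 + |x + c|) ^ (2 * b)) * g x ^ 2 := by
  have h := one_dim b B A h1 h2 hB κ hκm hκ hA (fun y => g (y - c)) (by fun_prop)
  rw [← lintegral_add_right_eq_self _ c,
    ← lintegral_add_right_eq_self (fun x => ENNReal.ofReal ((1 + |x|) ^ (2 * b)) * g (x - c) ^ 2) c] at h
  simp only [add_sub_cancel_right] at h
  have e : ∀ x : ℝ, ∫⁻ u, κ u * g (x - u) = ∫⁻ y, κ (x + c - y) * g (y - c) := by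
    intro x
    rw [← lintegral_sub_left_eq_self _ (x + c)]
    refine lintegral_congr fun y => ?_
    congr 2
    ring
  simp only [e]
  exact h

theorem stmt5 (s b₂ : ℝ) (h1 : 0 < b₂) (h2 : b₂ < 1 / 2)
    (η : ℝ → ℂ) (hηsmooth : ContDiff ℝ (⊤ : ℕ∞) η)
    (hηsupp : Function.support η ⊆ Set.Icc (-1 : ℝ) 1)
    (hηone : ∀ t ∈ Set.Icc (-(1 / 2) : ℝ) (1 / 2), η t = 1) :
    ∃ C > (0 : ℝ), ∀ T ∈ Set.Ioc (0 : ℝ) 1, ∀ F : SchwartzMap (ℝ × ℝ) ℂ,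
      Xnorm s b₂ (fun x t => η (t / T) * F (x, t)) ≤
        C * Xnorm s b₂ (fun x t => F (x, t)) := by
  obtain ⟨A, B, hA, hB, hK⟩ := cutoff_kernel η hηsmooth hηsupp
  have hb : 0 < 1/2 - b₂ := by linarith
  set c : ℝ := 8 * A ^ 2 + 2 * (2 * B) ^ 2 * (2 / (1/2 - b₂)) ^ 2 with hc
  have hc0 : 0 ≤ c := by positivity
  have hcE : ENNReal.ofReal c = 8 * ENNReal.ofReal A ^ 2 +
      2 * (ENNReal.ofReal (2 * B)) ^ 2 * (ENNReal.ofReal (2 / (1/2 - b₂))) ^ 2 := by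
    rw [hc, ENNReal.ofReal_add (by positivity) (by positivity), ENNReal.ofReal_mul (by positivity),
      ENNReal.ofReal_mul (by positivity), ENNReal.ofReal_mul (by positivity),
      ENNReal.ofReal_pow (by positivity), ENNReal.ofReal_pow (by positivity),
      ENNReal.ofReal_pow (by positivity)]
    simp
  refine ⟨Real.sqrt (c + 1), by positivity, fun T hT F => ?_⟩
  obtain ⟨K, hKc, hKi, hKη, hKA, hKB⟩ := hK T hT
  unfold Xnorm
  rw [← Real.sqrt_mul (by positivity)]
  apply Real.sqrt_le_sqrt
  have hint := X_integrable s b₂ h1 h2 F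
  set H : ℝ × ℝ → ℝ := fun z => (1 + |z.1|) ^ (2 * s) * (1 + |z.2 + z.1 ^ 5|) ^ (2 * b₂) *
      ‖FT2 (fun x t => F (x, t)) z.1 z.2‖ ^ 2 with hH
  have hH0 : ∀ z, 0 ≤ H z := fun z => by positivity
  have hR : ENNReal.ofReal (∫ ξ : ℝ, ∫ τ : ℝ, H (ξ, τ)) = ∫⁻ ξ : ℝ, ∫⁻ τ : ℝ, ENNReal.ofReal (H (ξ, τ)) := by
    rw [Measure.volume_eq_prod] at hint
    rw [← integral_prod _ hint, ofReal_integral_eq_lintegral_ofReal hint (Filter.Eventually.of_forall hH0),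
      lintegral_prod _ hint.1.aemeasurable.ennreal_ofReal]
  have hH1 : ∀ ξ τ, ENNReal.ofReal (H (ξ, τ)) = ENNReal.ofReal ((1 + |ξ|) ^ (2 * s)) *
      (ENNReal.ofReal ((1 + |τ + ξ ^ 5|) ^ (2 * b₂)) * ‖FT2 (fun x t => F (x, t)) ξ τ‖ₑ ^ 2) := by
    intro ξ τ
    rw [← ofReal_norm, ← ENNReal.ofReal_pow (by positivity), ← ENNReal.ofReal_mul (by positivity),
      ← ENNReal.ofReal_mul (by positivity), ← mul_assoc]
  have hI0 : 0 ≤ ∫ ξ : ℝ, ∫ τ : ℝ, H (ξ, τ) :=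
    integral_nonneg fun ξ => integral_nonneg fun τ => hH0 _
  suffices h : ENNReal.ofReal (∫ ξ : ℝ, ∫ τ : ℝ,
      (1 + |ξ|) ^ (2 * s) * (1 + |τ + ξ ^ 5|) ^ (2 * b₂) *
        ‖FT2 (fun x t => η (t / T) * F (x, t)) ξ τ‖ ^ 2) ≤
      ENNReal.ofReal (c * ∫ ξ : ℝ, ∫ τ : ℝ, H (ξ, τ)) by
    rw [ENNReal.ofReal_le_ofReal_iff (by positivity)] at h
    refine h.trans ?_
    exact mul_le_mul_of_nonneg_right (by linarith) hI0
  rw [ENNReal.ofReal_mul hc0, hR, ← lintegral_const_mul' _ _ ENNReal.ofReal_ne_top]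
  refine (ofReal_le_enorm _).trans ?_
  refine (enorm_integral_le_lintegral_enorm _).trans (lintegral_mono fun ξ => ?_)
  refine (enorm_integral_le_lintegral_enorm _).trans ?_
  have hgm : Measurable (fun τ => ‖FT2 (fun x t => F (x, t)) ξ τ‖ₑ) := by
    exact (FT2_cont_right F ξ).measurable.enorm
  have hod := one_dim_shift b₂ B (ξ ^ 5) (ENNReal.ofReal A) h1 h2 hB (fun u => ‖K u‖ₑ)
    hKc.measurable.enorm hKB hKA _ hgm
  rw [← hcE] at hod
  calc _ ≤ ∫⁻ τ, ENNReal.ofReal ((1 + |ξ|) ^ (2 * s)) * (ENNReal.ofReal ((1 + |τ + ξ ^ 5|) ^ (2 * b₂)) *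
        (∫⁻ u, ‖K u‖ₑ * ‖FT2 (fun x t => F (x, t)) ξ (τ - u)‖ₑ) ^ 2) := by
        refine lintegral_mono fun τ => ?_
        simp only
        rw [Real.enorm_of_nonneg (by positivity), mul_assoc, ENNReal.ofReal_mul (by positivity),
          ENNReal.ofReal_mul (by positivity), ENNReal.ofReal_pow (by positivity), ofReal_norm]
        gcongr
        rw [FT2_mul F K hKi (fun t => η (t / T)) hKη ξ τ]
        refine (enorm_integral_le_lintegral_enorm _).trans (le_of_eq ?_)
        simp only [enorm_mul]
    _ ≤ ENNReal.ofReal ((1 + |ξ|) ^ (2 * s)) * (ENNReal.ofReal c *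
          ∫⁻ τ, ENNReal.ofReal ((1 + |τ + ξ ^ 5|) ^ (2 * b₂)) * ‖FT2 (fun x t => F (x, t)) ξ τ‖ₑ ^ 2) := by
        rw [lintegral_const_mul' _ _ ENNReal.ofReal_ne_top]
        gcongr
    _ = _ := by
        simp only [hH1]
        rw [lintegral_const_mul' _ _ ENNReal.ofReal_ne_top]
        ring
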